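/- For every n ≥ 1 and every positive integer l, the number of (n,2) left Gog trapezoids with bottom entry X_{1,1} = l equals the number of (n,2) left GOGAm trapezoids with bottom entry X_{1,1} = l. -/

import Mathlib

/-- A Gelfand-Tsetlin triangle of size `n`: a triangular array `X i j` for
`n ≥ i ≥ j ≥ 1` of positive integers with `X (i+1) j ≤ X i j ≤ X (i+1) (j+1)`. -/
def IsGT (n : ℕ) (X : ℕ → ℕ → ℕ) : Prop :=
  (∀ i j, 1 ≤ j → j ≤ i → i ≤ n → 1 ≤ X i j) ∧
  (∀ i j, 1 ≤ j → j ≤ i → i + 1 ≤ n → X (i + 1) j ≤ X i j ∧ X i j ≤ X (i + 1) (j + 1))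

/-- A Gog triangle of size `n`: a Gelfand-Tsetlin triangle with strictly increasing
rows and top row `X n j = j`. -/
def IsGog (n : ℕ) (X : ℕ → ℕ → ℕ) : Prop :=
  IsGT n X ∧
  (∀ i j, 1 ≤ j → j + 1 ≤ i → i ≤ n → X i j < X i (j + 1)) ∧
  (∀ j, 1 ≤ j → j ≤ n → X n j = j)

/-- A GOGAm triangle of size `n`: a Gelfand-Tsetlin triangle with `X n n ≤ n` and,
for all `1 ≤ k ≤ n - 1` and all strictly decreasing sequences
`n = j 0 > j 1 > ⋯ > j (n - k) ≥ 1`,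
`(∑ i in range (n-k), (X (j i + i) (j i) - X (j (i+1) + i) (j (i+1))))
  + X (j (n-k) + (n-k)) (j (n-k)) ≤ k`. -/
def IsGOGAm (n : ℕ) (X : ℕ → ℕ → ℕ) : Prop :=
  IsGT n X ∧ X n n ≤ n ∧
  ∀ k : ℕ, 1 ≤ k → k ≤ n - 1 →
    ∀ j : ℕ → ℕ, j 0 = n → (∀ i, i < n - k → j (i + 1) < j i) → 1 ≤ j (n - k) →
      (∑ i ∈ Finset.range (n - k),
          ((X (j i + i) (j i) : ℤ) - (X (j (i + 1) + i) (j (i + 1)) : ℤ)))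
        + (X (j (n - k) + (n - k)) (j (n - k)) : ℤ) ≤ (k : ℤ)

/-- The set of `(n,k)` right Gog trapezoids, encoded as functions that agree with
some Gog triangle of size `n` on the `k` rightmost SW-NE diagonals
(`1 ≤ j ≤ i ≤ n`, `i - j ≤ k - 1`, i.e. `i < j + k`) and vanish elsewhere. -/
def RightGogTrapSet (n k : ℕ) : Set (ℕ → ℕ → ℕ) :=
  { X | ∃ Z, IsGog n Z ∧
      ∀ i j, X i j = if 1 ≤ j ∧ j ≤ i ∧ i ≤ n ∧ i < j + k then Z i j else 0 }

/-- The set of `(n,k)` left Gog trapezoids, encoded as functions that agree with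
some Gog triangle of size `n` on the `k` leftmost NW-SE diagonals
(`1 ≤ j ≤ i ≤ n`, `j ≤ k`) and vanish elsewhere. -/
def LeftGogTrapSet (n k : ℕ) : Set (ℕ → ℕ → ℕ) :=
  { X | ∃ Z, IsGog n Z ∧
      ∀ i j, X i j = if 1 ≤ j ∧ j ≤ i ∧ i ≤ n ∧ j ≤ k then Z i j else 0 }

/-- The set of `(n,k)` right GOGAm trapezoids, encoded as functions that agree with
some GOGAm triangle of size `n` on the `k` rightmost SW-NE diagonals and vanish
elsewhere. -/
def RightGOGAmTrapSet (n k : ℕ) : Set (ℕ → ℕ → ℕ) :=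
  { X | ∃ Z, IsGOGAm n Z ∧
      ∀ i j, X i j = if 1 ≤ j ∧ j ≤ i ∧ i ≤ n ∧ i < j + k then Z i j else 0 }

/-- The set of `(n,k)` left GOGAm trapezoids, encoded as functions that agree with
some GOGAm triangle of size `n` on the `k` leftmost NW-SE diagonals and vanish
elsewhere. -/
def LeftGOGAmTrapSet (n k : ℕ) : Set (ℕ → ℕ → ℕ) :=
  { X | ∃ Z, IsGOGAm n Z ∧
      ∀ i j, X i j = if 1 ≤ j ∧ j ≤ i ∧ i ≤ n ∧ j ≤ k then Z i j else 0 }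

/-- `f` is a sequence of pairs starting at `(1, 1)`, of length `t`, each term of which is an
allowed predecessor of the following one; it is extended by `(0, 0)` after time `t`. -/
def IsPath (P : ℕ → ℕ × ℕ → Finset (ℕ × ℕ)) (t : ℕ) (f : ℕ → ℕ × ℕ) : Prop :=
  f 0 = (1, 1) ∧ (∀ i < t, f i ∈ P i (f (i + 1))) ∧ ∀ i, t < i → f i = (0, 0)

open Classical in
/-- The finite set of paths of length `t` ending at `s`. -/
noncomputable def pathsTo (P : ℕ → ℕ × ℕ → Finset (ℕ × ℕ)) : ℕ → ℕ × ℕ → Finset (ℕ → ℕ × ℕ)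
  | 0, s => if s = (1, 1) then {fun i => if i = 0 then (1, 1) else (0, 0)} else ∅
  | t + 1, s =>
    (P t s).biUnion fun p => (pathsTo P t p).image fun f => Function.update f (t + 1) s

theorem mem_pathsTo (P : ℕ → ℕ × ℕ → Finset (ℕ × ℕ)) (t : ℕ) (s : ℕ × ℕ) (f : ℕ → ℕ × ℕ) :
    f ∈ pathsTo P t s ↔ IsPath P t f ∧ f t = s := by
  induction t generalizing s f with
  | zero =>
    unfold pathsTo IsPath
    split_ifs with h
    · subst h
      simp only [Finset.mem_singleton]
      constructor
      · rintro rfl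
        refine ⟨⟨by simp, by simp, fun i hi => by simp [hi.ne']⟩, by simp⟩
      · rintro ⟨⟨h0, -, h⟩, -⟩
        funext i
        rcases Nat.eq_zero_or_pos i with rfl | hi
        · simpa using h0
        · simpa [hi.ne'] using h i hi
    · simp only [Finset.notMem_empty, false_iff]
      rintro ⟨⟨h0, -⟩, h1⟩
      exact h (h1.symm.trans h0)
  | succ t ih =>
    simp only [pathsTo, Finset.mem_biUnion, Finset.mem_image, ih]
    constructor
    · rintro ⟨p, hp, g, ⟨⟨h0, h1, h2⟩, rfl⟩, rfl⟩
      refine ⟨⟨by simpa [Function.update] using h0, fun i hi => ?_, fun i hi => ?_⟩, by simp⟩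
      · rcases Nat.lt_succ_iff_lt_or_eq.1 hi with hi | hi
        · rw [Function.update_of_ne (by omega), Function.update_of_ne (by omega)]
          exact h1 i hi
        · subst i
          rw [Function.update_self, Function.update_of_ne (by omega)]
          exact hp
      · rw [Function.update_of_ne (by omega)]
        exact h2 i (by omega)
    · rintro ⟨⟨h0, h1, h2⟩, rfl⟩
      refine ⟨f t, h1 t (by omega), Function.update f (t + 1) (0, 0), ⟨⟨?_, ?_, ?_⟩, ?_⟩, ?_⟩
      · rw [Function.update_of_ne (by omega), h0]
      · intro i hi
        rw [Function.update_of_ne (by omega), Function.update_of_ne (by omega)]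
        exact h1 i (by omega)
      · intro i hi
        by_cases h : i = t + 1
        · simp [h]
        · rw [Function.update_of_ne h]
          exact h2 i (by omega)
      · rw [Function.update_of_ne (by omega)]
      · simp

theorem card_pathsTo_succ (P : ℕ → ℕ × ℕ → Finset (ℕ × ℕ)) (t : ℕ) (s : ℕ × ℕ) :
    (pathsTo P (t + 1) s).card = ∑ p ∈ P t s, (pathsTo P t p).card := by
  classical
  simp only [pathsTo]
  rw [Finset.card_biUnion]
  · refine Finset.sum_congr rfl fun p _ => Finset.card_image_of_injOn ?_
    intro f hf g hg hfg
    simp only [Finset.mem_coe, mem_pathsTo] at hf hg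
    funext i
    by_cases h : i = t + 1
    · rw [hf.1.2.2 i (by omega), hg.1.2.2 i (by omega)]
    · simpa [h] using congrFun hfg i
  · intro p _ q _ hpq
    rw [Function.onFun, Finset.disjoint_left]
    intro f hf hg
    simp only [Finset.mem_image, mem_pathsTo] at hf hg
    obtain ⟨f, ⟨-, hf⟩, rfl⟩ := hf
    obtain ⟨g, ⟨-, hg⟩, hfg⟩ := hg
    apply hpq
    rw [← hf, ← hg]
    simpa using (congrFun hfg t).symm

/-- The width-two array of size `n` whose two diagonals are read off from a path. -/
def ofPath (n : ℕ) (f : ℕ → ℕ × ℕ) (i j : ℕ) : ℕ :=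
  if 1 ≤ i ∧ i ≤ n ∧ j = 1 then (f (n - i)).1
  else if 2 ≤ i ∧ i ≤ n ∧ j = 2 then (f (n - i + 1)).2 else 0

theorem ofPath_injOn (P : ℕ → ℕ × ℕ → Finset (ℕ × ℕ)) {n : ℕ} {f g : ℕ → ℕ × ℕ}
    (hf : IsPath P (n - 1) f) (hg : IsPath P (n - 1) g) (h : ofPath n f = ofPath n g) :
    f = g := by
  funext t
  rcases Nat.eq_zero_or_pos t with rfl | ht
  · rw [hf.1, hg.1]
  by_cases htn : n - 1 < t
  · rw [hf.2.2 t htn, hg.2.2 t htn]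
  have h1 := congrFun (congrFun h (n - t)) 1
  have h2 := congrFun (congrFun h (n - t + 1)) 2
  unfold ofPath at h1 h2
  rw [if_pos (by omega), if_pos (by omega)] at h1
  rw [if_neg (by omega), if_pos (by omega), if_neg (by omega), if_pos (by omega)] at h2
  rw [show n - (n - t) = t by omega] at h1
  rw [show n - (n - t + 1) + 1 = t by omega] at h2
  exact Prod.ext h1 h2

theorem ncard_eq_sum_pathsTo (P : ℕ → ℕ × ℕ → Finset (ℕ × ℕ))
    (hP : ∀ t p q, p ∈ P t q → q.2 ≤ t + 2) (n l : ℕ) (hn : 1 ≤ n)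
    (S : Set (ℕ → ℕ → ℕ)) (hS : ∀ X, X ∈ S ↔ ∃ f, IsPath P (n - 1) f ∧ X = ofPath n f) :
    Set.ncard {X | X ∈ S ∧ X 1 1 = l} =
      ∑ b ∈ Finset.range (n + 1), (pathsTo P (n - 1) (l, b)).card := by
  classical
  have key : {X | X ∈ S ∧ X 1 1 = l} = (((Finset.range (n + 1)).biUnion fun b =>
      pathsTo P (n - 1) (l, b)).image (ofPath n) : Finset (ℕ → ℕ → ℕ)) := by
    ext X
    simp only [Set.mem_ofPred_eq, hS, Finset.coe_image, Set.mem_image, Finset.mem_coe,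
      Finset.mem_biUnion, Finset.mem_range, mem_pathsTo]
    constructor
    · rintro ⟨⟨f, hf, rfl⟩, h⟩
      have h1 : (f (n - 1)).1 = l := by rw [← h, ofPath, if_pos (by omega)]
      refine ⟨f, ⟨(f (n - 1)).2, ?_, hf, by rw [← h1]⟩, rfl⟩
      rcases Nat.eq_zero_or_pos (n - 1) with h0 | h0
      · rw [h0, hf.1]; omega
      · have := hP _ _ _ (hf.2.1 (n - 2) (by omega))
        rw [show n - 2 + 1 = n - 1 by omega] at this
        omega
    · rintro ⟨f, ⟨b, -, hf, h⟩, rfl⟩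
      exact ⟨⟨f, hf, rfl⟩, by rw [ofPath, if_pos (by omega), h]⟩
  rw [key, Set.ncard_coe_finset, Finset.card_image_of_injOn, Finset.card_biUnion]
  · intro b _ c _ hbc
    rw [Function.onFun, Finset.disjoint_left]
    intro f hf hg
    rw [mem_pathsTo] at hf hg
    exact hbc (congrArg Prod.snd (hf.2.symm.trans hg.2))
  · intro f hf g hg h
    simp only [Finset.mem_coe, Finset.mem_biUnion, mem_pathsTo] at hf hg
    obtain ⟨_, _, hf, _⟩ := hf
    obtain ⟨_, _, hg, _⟩ := hg
    exact ofPath_injOn P hf hg h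

/-- Admissible predecessors of a pair in a Gog path. -/
def gogPred (t : ℕ) (q : ℕ × ℕ) : Finset (ℕ × ℕ) :=
  (Finset.range (q.1 + 1) ×ˢ Finset.range (q.2 + 1)).filter fun p =>
    q.1 ≤ q.2 ∧ q.2 ≤ t + 2 ∧ p.1 < q.2

/-- Admissible predecessors of a pair in a GOGAm path. -/
def gogamPred (t : ℕ) (q : ℕ × ℕ) : Finset (ℕ × ℕ) :=
  (Finset.range (q.1 + 1) ×ˢ Finset.range (q.2 + 1)).filter fun p =>
    q.1 ≤ q.2 ∧ q.2 ≤ t + 2 ∧ q.2 + p.1 ≤ t + 1 + q.1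

theorem mem_gogPred {t : ℕ} {p q : ℕ × ℕ} :
    p ∈ gogPred t q ↔ p.1 ≤ q.1 ∧ p.2 ≤ q.2 ∧ q.1 ≤ q.2 ∧ q.2 ≤ t + 2 ∧ p.1 < q.2 := by
  simp [gogPred, and_assoc]

theorem mem_gogamPred {t : ℕ} {p q : ℕ × ℕ} :
    p ∈ gogamPred t q ↔
      p.1 ≤ q.1 ∧ p.2 ≤ q.2 ∧ q.1 ≤ q.2 ∧ q.2 ≤ t + 2 ∧ q.2 + p.1 ≤ t + 1 + q.1 := by
  simp [gogamPred, and_assoc]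

/-- The sum of `g` over the rectangle `[0, a) × [0, b)`. -/
def rectSum (g : ℕ → ℕ → ℤ) (a b : ℕ) : ℤ :=
  ∑ x ∈ Finset.range a, ∑ y ∈ Finset.range b, g x y

/-- The number of Gog paths of length `t` ending at `(a, b)`. -/
noncomputable def gogCount (t a b : ℕ) : ℤ := (pathsTo gogPred t (a, b)).card

/-- The number of GOGAm paths of length `t` ending at `(a, b)`. -/
noncomputable def gogamCount (t a b : ℕ) : ℤ := (pathsTo gogamPred t (a, b)).card

theorem gogCount_succ (t a b : ℕ) : gogCount (t + 1) a b =
    if a ≤ b ∧ b ≤ t + 2 then rectSum (gogCount t) (min (a + 1) b) (b + 1) else 0 := by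
  unfold gogCount rectSum
  rw [card_pathsTo_succ]
  push_cast
  split_ifs with h
  · rw [← Finset.sum_product']
    refine Finset.sum_congr ?_ fun p _ => rfl
    ext p
    simp only [mem_gogPred, Finset.mem_product, Finset.mem_range]
    omega
  · refine Finset.sum_eq_zero fun p hp => ?_
    rw [mem_gogPred] at hp
    omega

theorem gogamCount_succ (t a b : ℕ) : gogamCount (t + 1) a b =
    if a ≤ b ∧ b ≤ t + 2 then
      rectSum (gogamCount t) (if b = t + 2 then a else a + 1) (b + 1) else 0 := by
  unfold gogamCount rectSum
  rw [card_pathsTo_succ]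
  push_cast
  split_ifs with h
  all_goals first
    | rw [← Finset.sum_product']
      refine Finset.sum_congr ?_ fun p _ => rfl
      ext p
      simp only [mem_gogamPred, Finset.mem_product, Finset.mem_range]
      omega
    | refine Finset.sum_eq_zero fun p hp => ?_
      rw [mem_gogamPred] at hp
      omega

theorem rectSum_succ_left (g : ℕ → ℕ → ℤ) (a b : ℕ) :
    rectSum g (a + 1) b = rectSum g a b + ∑ y ∈ Finset.range b, g a y :=
  Finset.sum_range_succ _ _

theorem rectSum_succ_right (g : ℕ → ℕ → ℤ) (a b : ℕ) :
    rectSum g a (b + 1) = rectSum g a b + ∑ x ∈ Finset.range a, g x b := by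
  simp only [rectSum, Finset.sum_range_succ, Finset.sum_add_distrib]

/-- The linear relation between the Gog and GOGAm counting functions at time `t`, together with
the support conditions needed to propagate it. -/
structure Related (t : ℕ) (g h : ℕ → ℕ → ℤ) : Prop where
  gog_zero : ∀ b, g 0 b = 0
  gog_lt : ∀ a b, b < a → g a b = 0
  gog_gt : ∀ a b, t + 1 < b → g a b = 0
  gogam_zero : ∀ b, h 0 b = 0
  gogam_lt : ∀ a b, b < a → h a b = 0
  gogam_gt : ∀ a b, t + 1 < b → h a b = 0
  gog_diag : ∀ a, g a (a + 1) = g (a + 1) (a + 1)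
  rel : ∀ a b, a < b → h (a + 1) b = g (a + 1) (b + 1) + g a b - g a (b + 1)

namespace Related

variable {t : ℕ} {g h : ℕ → ℕ → ℤ}

theorem sum_row (H : Related t g h) {a b : ℕ} (hab : a < b) :
    ∑ y ∈ Finset.range b, h (a + 1) y = ∑ y ∈ Finset.range (b + 1), g (a + 1) y - g a b := by
  induction b, hab using Nat.le_induction with
  | base =>
    rw [Finset.sum_range_succ _ (a + 1), H.gog_diag, add_sub_cancel_right,
      Finset.sum_eq_zero, Finset.sum_eq_zero]
    · intro y hy; exact H.gog_lt _ _ (Finset.mem_range.1 hy)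
    · intro y hy; exact H.gogam_lt _ _ (Finset.mem_range.1 hy)
  | succ b hb ih =>
    rw [Finset.sum_range_succ, ih, Finset.sum_range_succ _ (b + 1), H.rel a b hb]
    ring

theorem rectSum_eq (H : Related t g h) {a b : ℕ} (hab : a < b) :
    rectSum h (a + 1) b = rectSum g (a + 1) (b + 1) - rectSum g a (b + 1) + rectSum g a b := by
  induction a with
  | zero => simp [rectSum, H.gog_zero, H.gogam_zero]
  | succ a ih =>
    rw [rectSum_succ_left, ih (by omega), H.sum_row (by omega)]
    simp only [rectSum_succ_left, Finset.sum_range_succ]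
    ring

theorem sum_row_total (H : Related t g h) (a : ℕ) :
    ∑ y ∈ Finset.range (t + 2), h a y = ∑ y ∈ Finset.range (t + 2), g a y := by
  rcases a with _ | a
  · simp [H.gog_zero, H.gogam_zero]
  by_cases ha : a < t + 2
  · rw [H.sum_row ha, Finset.sum_range_succ, H.gog_gt _ _ (by omega), H.gog_gt _ _ (by omega)]
    ring
  · rw [Finset.sum_eq_zero, Finset.sum_eq_zero]
    · intro y hy; exact H.gog_lt _ _ (by have := Finset.mem_range.1 hy; omega)
    · intro y hy; exact H.gogam_lt _ _ (by have := Finset.mem_range.1 hy; omega)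

end Related

theorem rectSum_single (a b : ℕ) :
    rectSum (fun x y => if (x, y) = (1, 1) then 1 else 0) a b = if 1 < a ∧ 1 < b then 1 else 0 := by
  unfold rectSum
  simp only [Prod.mk.injEq, ite_and, Finset.sum_ite_eq', Finset.sum_ite_irrel,
    Finset.sum_const_zero, Finset.mem_range]

theorem gogCount_zero : gogCount 0 = fun x y => if (x, y) = (1, 1) then 1 else 0 := by
  funext x y
  unfold gogCount pathsTo
  split_ifs <;> simp

theorem gogamCount_zero : gogamCount 0 = fun x y => if (x, y) = (1, 1) then 1 else 0 := by
  funext x y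
  unfold gogamCount pathsTo
  split_ifs <;> simp

theorem related_one : Related 1 (gogCount 1) (gogamCount 1) := by
  constructor <;> intros <;>
    simp only [gogCount_succ, gogamCount_succ, gogCount_zero, gogamCount_zero, rectSum_single] <;>
    split_ifs <;> omega

theorem Related.succ {t : ℕ} (H : Related t (gogCount t) (gogamCount t)) :
    Related (t + 1) (gogCount (t + 1)) (gogamCount (t + 1)) := by
  have hz : ∀ b, rectSum (gogCount t) 1 b = 0 := fun b => by simp [rectSum, H.gog_zero]
  have hz' : ∀ b, rectSum (gogamCount t) 1 b = 0 := fun b => by simp [rectSum, H.gogam_zero]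
  have h0 : ∀ g b, rectSum g 0 b = 0 := fun g b => by simp [rectSum]
  constructor
  · intro b
    rw [gogCount_succ]
    split_ifs
    · rcases b with _ | b <;> simp [h0, hz]
    · rfl
  · intro a b hab
    rw [gogCount_succ, if_neg (by omega)]
  · intro a b hb
    rw [gogCount_succ, if_neg (by omega)]
  · intro b
    rw [gogamCount_succ]
    split_ifs <;> simp [h0, hz']
  · intro a b hab
    rw [gogamCount_succ, if_neg (by omega)]
  · intro a b hb
    rw [gogamCount_succ, if_neg (by omega)]
  · intro a
    simp [gogCount_succ]
  · intro a b hab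
    simp only [gogCount_succ, gogamCount_succ]
    have hr : ∀ x, rectSum (gogCount t) x (t + 2 + 1) = rectSum (gogCount t) x (t + 2) := by
      intro x
      rw [rectSum_succ_right, Finset.sum_eq_zero, add_zero]
      exact fun y _ => H.gog_gt _ _ (by omega)
    have hr' : ∀ x, rectSum (gogamCount t) x (t + 2 + 1) = rectSum (gogamCount t) x (t + 2) := by
      intro x
      rw [rectSum_succ_right, Finset.sum_eq_zero, add_zero]
      exact fun y _ => H.gogam_gt _ _ (by omega)
    rcases lt_trichotomy b (t + 2) with hb | rfl | hb
    · rw [if_pos (by omega), if_neg (by omega), if_pos (by omega), if_pos (by omega),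
        if_pos (by omega), min_eq_left (by omega), min_eq_left (by omega), min_eq_left (by omega),
        H.rectSum_eq (by omega)]
      ring
    · rw [if_pos (by omega), if_pos rfl, if_neg (by omega), if_pos (by omega), if_neg (by omega),
        min_eq_left (by omega), hr, hr']
      rcases a with _ | a
      · simp [hz, hz']
      · rw [H.rectSum_eq (by omega), hr, hr]
        ring
    · rw [if_neg (by omega), if_neg (by omega), if_neg (by omega), if_neg (by omega)]
      ring

theorem related (t : ℕ) : Related (t + 1) (gogCount (t + 1)) (gogamCount (t + 1)) := by
  induction t with
  | zero => exact related_one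
  | succ t ih => exact ih.succ

theorem sum_card_gog_eq (n l : ℕ) (hn : 1 ≤ n) :
    ∑ b ∈ Finset.range (n + 1), (pathsTo gogPred (n - 1) (l, b)).card =
      ∑ b ∈ Finset.range (n + 1), (pathsTo gogamPred (n - 1) (l, b)).card := by
  obtain ⟨_ | t, rfl⟩ := Nat.exists_eq_add_of_le' hn
  · rfl
  · have := (related t).sum_row_total l
    simp only [gogCount, gogamCount] at this
    exact_mod_cast this.symm

theorem IsPath.bounds {P : ℕ → ℕ × ℕ → Finset (ℕ × ℕ)}
    (hP : ∀ t p q, p ∈ P t q → p.1 ≤ q.1 ∧ q.1 ≤ q.2 ∧ q.2 ≤ t + 2) {n : ℕ} {f : ℕ → ℕ × ℕ}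
    (hf : IsPath P n f) {t : ℕ} (ht : t ≤ n) :
    1 ≤ (f t).1 ∧ (f t).1 ≤ (f t).2 ∧ (f t).2 ≤ t + 1 := by
  induction t with
  | zero => simp [hf.1]
  | succ t ih =>
    have h1 := ih (by omega)
    have h2 := hP _ _ _ (hf.2.1 t (by omega))
    omega

/-- The path read off from the two leftmost diagonals of a triangle of size `n`. -/
def toPath (n : ℕ) (Z : ℕ → ℕ → ℕ) (t : ℕ) : ℕ × ℕ :=
  if t = 0 then (1, 1) else if t < n then (Z (n - t) 1, Z (n - t + 1) 2) else (0, 0)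

theorem toPath_of_lt {n : ℕ} (Z : ℕ → ℕ → ℕ) {i t : ℕ} (hi : 1 ≤ i) (ht : 1 ≤ t)
    (h : n = i + t) : toPath n Z t = (Z i 1, Z (i + 1) 2) := by
  rw [toPath, if_neg (by omega), if_pos (by omega), show n - t = i by omega]

theorem isPath_toPath (P : ℕ → ℕ × ℕ → Finset (ℕ × ℕ)) {n : ℕ} (hn : 1 ≤ n) {Z : ℕ → ℕ → ℕ}
    (h0 : ∀ i, 1 ≤ i → n = i + 1 → (1, 1) ∈ P 0 (Z i 1, Z (i + 1) 2))
    (h1 : ∀ i t, 1 ≤ i → n = i + t + 2 →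
      (Z (i + 1) 1, Z (i + 2) 2) ∈ P (t + 1) (Z i 1, Z (i + 1) 2)) :
    IsPath P (n - 1) (toPath n Z) := by
  refine ⟨by simp [toPath], fun t ht => ?_, fun t ht => ?_⟩
  · obtain ⟨i, hi⟩ : ∃ i, n = i + (t + 1) := ⟨n - (t + 1), by omega⟩
    rw [toPath_of_lt Z (i := i) (t := t + 1) (by omega) (by omega) hi]
    rcases t with _ | t
    · exact h0 i (by omega) hi
    · rw [toPath_of_lt Z (i := i + 1) (by omega) (by omega) (by omega)]
      exact h1 i t (by omega) (by omega)
  · rw [toPath, if_neg (by omega), if_neg (by omega)]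

theorem ofPath_toPath {n : ℕ} {X Z : ℕ → ℕ → ℕ} (hZ : Z n 1 = 1)
    (hX : ∀ i j, X i j = if 1 ≤ j ∧ j ≤ i ∧ i ≤ n ∧ j ≤ 2 then Z i j else 0) :
    X = ofPath n (toPath n Z) := by
  funext i j
  rw [hX]
  unfold ofPath
  split_ifs with h1 h2 h3 h4 h5
  · obtain ⟨-, hi, rfl⟩ := h2
    rcases hi.eq_or_lt with rfl | hi
    · simp [toPath, hZ]
    · rw [toPath_of_lt Z (i := i) (by omega) (by omega) (by omega)]
  · obtain ⟨-, hi, rfl⟩ := h3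
    rw [toPath_of_lt Z (i := i - 1) (by omega) (by omega) (by omega),
      show i - 1 + 1 = i by omega]
  all_goals omega

theorem IsGT.le_add {n : ℕ} {Z : ℕ → ℕ → ℕ} (hZ : IsGT n Z) {i j : ℕ} (hj : 1 ≤ j) (hji : j ≤ i)
    (d : ℕ) (hd : i + d ≤ n) : Z i j ≤ Z (i + d) (j + d) := by
  induction d with
  | zero => exact le_rfl
  | succ d ih => exact (ih (by omega)).trans (hZ.2 (i + d) (j + d) (by omega) (by omega) hd).2

theorem mem_leftGog_iff (n : ℕ) (hn : 1 ≤ n) (X : ℕ → ℕ → ℕ) :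
    X ∈ LeftGogTrapSet n 2 ↔ ∃ f, IsPath gogPred (n - 1) f ∧ X = ofPath n f := by
  constructor
  · rintro ⟨Z, ⟨hGT, hlt, htop⟩, hX⟩
    refine ⟨toPath n Z, isPath_toPath _ hn ?_ ?_, ofPath_toPath (htop 1 le_rfl hn) hX⟩
    · rintro i hi rfl
      have h2 := htop 2 (by omega) (by omega)
      have h3 := hGT.1 i 1 le_rfl hi (by omega)
      have h4 := (hGT.2 i 1 le_rfl hi le_rfl).2
      simp only [mem_gogPred, Nat.reduceAdd] at *
      omega
    · rintro i t hi rfl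
      have h1 := hGT.2 i 1 le_rfl hi (by omega)
      have h2 := hGT.2 (i + 1) 2 (by omega) (by omega) (by omega)
      have h3 := hlt (i + 1) 1 le_rfl (by omega) (by omega)
      have h4 := hGT.le_add (i := i + 1) (j := 2) (by omega) (by omega) (t + 1) (by omega)
      rw [show i + 1 + (t + 1) = i + t + 2 by omega, htop _ (by omega) (by omega)] at h4
      simp only [mem_gogPred]
      simp only [add_assoc, Nat.reduceAdd] at *
      omega
  · rintro ⟨f, hf, rfl⟩
    have hb : ∀ t, t < n → 1 ≤ (f t).1 ∧ (f t).1 ≤ (f t).2 ∧ (f t).2 ≤ t + 1 := fun t ht =>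
      hf.bounds (fun t p q h => by rw [mem_gogPred] at h; omega) (by omega)
    have hs : ∀ t, t + 1 < n → _ := fun t ht => mem_gogPred.1 (hf.2.1 t (by omega))
    refine ⟨fun i j => if j = 1 then (f (n - i)).1 else if j = 2 then (f (n - i + 1)).2
      else n - i + j, ⟨⟨?_, ?_⟩, ?_, ?_⟩, ?_⟩
    · intro i j hj hji hi
      dsimp only
      split_ifs
      · exact (hb _ (by omega)).1
      · have := hb (n - i + 1) (by omega)
        omega
      · omega
    · intro i j hj hji hi
      obtain ⟨t, rfl⟩ := Nat.exists_eq_add_of_le hi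
      have h1 := hs t (by omega)
      have e1 : i + 1 + t - i = t + 1 := by omega
      have e2 : i + 1 + t - (i + 1) = t := by omega
      simp only [e1, e2]
      rcases (by omega : j = 1 ∨ j = 2 ∨ 3 ≤ j) with rfl | rfl | hj
      · have := hb (t + 1) (by omega)
        simp
        omega
      · have h2 := hs (t + 1) (by omega)
        simp
        omega
      · rw [if_neg (by omega), if_neg (by omega), if_neg (by omega), if_neg (by omega),
          if_neg (by omega), if_neg (by omega)]
        omega
    · intro i j hj hji hi
      dsimp only
      rcases (by omega : j = 1 ∨ j = 2 ∨ 3 ≤ j) with rfl | rfl | hj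
      · have := hs (n - i) (by omega)
        simp
        omega
      · have := hb (n - i + 1) (by omega)
        simp
        omega
      · rw [if_neg (by omega), if_neg (by omega), if_neg (by omega), if_neg (by omega)]
        omega
    · intro j hj hjn
      dsimp only
      rcases (by omega : j = 1 ∨ j = 2 ∨ 3 ≤ j) with rfl | rfl | hj
      · simp [hf.1]
      · have := hs 0 (by omega)
        simp [hf.1] at this ⊢
        omega
      · rw [if_neg (by omega), if_neg (by omega)]
        omega
    · intro i j
      unfold ofPath
      dsimp only
      split_ifs <;> first | rfl | omega

theorem IsGOGAm.add_le {n : ℕ} {Z : ℕ → ℕ → ℕ} (hZ : IsGOGAm n Z) {c m : ℕ} (hc : 1 ≤ c)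
    (hm : c + m + 1 ≤ n) :
    Z (c + m + 1) (c + 1) + Z (c + m + 1) c + (m + 1) ≤ n + Z (c + m) c := by
  obtain ⟨hGT, -, h⟩ := hZ
  have hk : n - (n - (m + 1)) = m + 1 := by omega
  have hdec : ∀ i < m + 1, (if i + 1 = 0 then n else c + (m + 1) - (i + 1)) <
      if i = 0 then n else c + (m + 1) - i := by
    intro i hi
    rw [if_neg (Nat.succ_ne_zero i)]
    rcases Nat.eq_zero_or_pos i with rfl | h0
    · rw [if_pos rfl]
      omega
    · rw [if_neg h0.ne']
      omega
  have hpos : 1 ≤ if m + 1 = 0 then n else c + (m + 1) - (m + 1) := by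
    rw [if_neg (Nat.succ_ne_zero m)]
    omega
  have key := h (n - (m + 1)) (by omega) (by omega)
    (fun i => if i = 0 then n else c + (m + 1) - i) rfl (by rwa [hk]) (by rwa [hk])
  rw [hk, Finset.sum_range_succ] at key
  have hterm : ∀ i, i < m + 1 → Z (c + m + 1) (c + m + 1 - i) ≤
      Z ((if i = 0 then n else c + (m + 1) - i) + i) (if i = 0 then n else c + (m + 1) - i) := by
    intro i hi
    split_ifs with h0
    · subst h0
      have := hGT.le_add (i := c + m + 1) (j := c + m + 1) (by omega) le_rfl
        (n - (c + m + 1)) (by omega)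
      rwa [show c + m + 1 + (n - (c + m + 1)) = n by omega] at this
    · rw [show c + (m + 1) - i + i = c + m + 1 by omega, add_assoc]
  have hsum : 0 ≤ ∑ i ∈ Finset.range m,
      ((Z ((if i = 0 then n else c + (m + 1) - i) + i)
          (if i = 0 then n else c + (m + 1) - i) : ℤ) -
        (Z ((if i + 1 = 0 then n else c + (m + 1) - (i + 1)) + i)
          (if i + 1 = 0 then n else c + (m + 1) - (i + 1)) : ℤ)) := by
    refine Finset.sum_nonneg fun i hi => ?_
    rw [Finset.mem_range] at hi
    have h1 := hterm i (by omega)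
    have h2 := (hGT.2 (c + m) (c + m - i) (by omega) (by omega) hm).2
    rw [if_neg (Nat.succ_ne_zero i), show c + (m + 1) - (i + 1) + i = c + m by omega,
      show c + (m + 1) - (i + 1) = c + m - i by omega]
    rw [show c + m - i + 1 = c + m + 1 - i by omega] at h2
    omega
  have hlast := hterm m (by omega)
  rw [show c + m + 1 - m = c + 1 by omega] at hlast
  rw [if_neg (Nat.succ_ne_zero m), show c + (m + 1) - (m + 1) = c by omega,
    ← add_assoc c m 1] at key
  simp only [← add_assoc] at *
  omega

theorem mem_leftGOGAm_iff (n : ℕ) (hn : 1 ≤ n) (X : ℕ → ℕ → ℕ) :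
    X ∈ LeftGOGAmTrapSet n 2 ↔ ∃ f, IsPath gogamPred (n - 1) f ∧ X = ofPath n f := by
  constructor
  · rintro ⟨Z, hZ, hX⟩
    have hGT := hZ.1
    have hnn := hZ.2.1
    have htop : Z n 1 = 1 := by
      have h1 := hGT.1 n 1 le_rfl hn le_rfl
      rcases hn.eq_or_lt with rfl | hn
      · omega
      · obtain ⟨m, rfl⟩ := Nat.exists_eq_add_of_le hn
        have h2 := hZ.add_le (c := 1) (m := m) le_rfl (by omega)
        have h3 := (hGT.2 (1 + m) 1 le_rfl (by omega) (by omega)).2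
        simp only [Nat.succ_eq_add_one, add_right_comm 1 m 1, Nat.reduceAdd] at *
        omega
    refine ⟨toPath n Z, isPath_toPath _ hn ?_ ?_, ofPath_toPath htop hX⟩
    · rintro i hi rfl
      have h3 := hGT.1 i 1 le_rfl hi (by omega)
      have h4 := (hGT.2 i 1 le_rfl hi le_rfl).2
      have h5 : Z (i + 1) 2 ≤ 2 := by
        rcases hi.eq_or_lt with rfl | hi
        · exact hnn
        · obtain ⟨m, rfl⟩ := Nat.exists_eq_add_of_le hi
          have h5 := hZ.add_le (c := 2) (m := m) (by omega) (by omega)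
          have h6 := (hGT.2 (2 + m) 2 (by omega) (by omega) (by omega)).2
          simp only [Nat.succ_eq_add_one, Nat.reduceAdd] at *
          omega
      have h6 := hZ.add_le (c := 1) (m := i - 1) (by omega) (by omega)
      rw [show 1 + (i - 1) = i by omega] at h6
      simp only [mem_gogamPred, Nat.reduceAdd] at *
      omega
    · rintro i t hi rfl
      have h1 := hGT.2 i 1 le_rfl hi (by omega)
      have h2 := hGT.2 (i + 1) 2 (by omega) (by omega) (by omega)
      have h5 : Z (i + 1) 2 ≤ t + 3 := by
        rcases hi.eq_or_lt with rfl | hi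
        · have := hGT.le_add (i := 2) (j := 2) (by omega) (by omega) (t + 1) (by omega)
          rw [show 2 + (t + 1) = 1 + t + 2 by omega] at this
          simp only [Nat.reduceAdd] at *
          omega
        · have h5 := hZ.add_le (c := 2) (m := i - 2) (by omega) (by omega)
          have h6 := (hGT.2 i 2 (by omega) (by omega) (by omega)).2
          rw [show 2 + (i - 2) = i by omega] at h5
          simp only [Nat.reduceAdd] at *
          omega
      have h6 := hZ.add_le (c := 1) (m := i - 1) (by omega) (by omega)
      rw [show 1 + (i - 1) = i by omega] at h6
      simp only [mem_gogamPred]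
      simp only [add_assoc, Nat.reduceAdd] at *
      omega
  · rintro ⟨f, hf, rfl⟩
    have hb : ∀ t, t < n → 1 ≤ (f t).1 ∧ (f t).1 ≤ (f t).2 ∧ (f t).2 ≤ t + 1 := fun t ht =>
      hf.bounds (fun t p q h => by rw [mem_gogamPred] at h; omega) (by omega)
    have hs : ∀ t, t + 1 < n → _ := fun t ht => mem_gogamPred.1 (hf.2.1 t (by omega))
    refine ⟨fun i j => if j = 1 then (f (n - i)).1 else (f (n - i + j - 1)).2,
      ⟨⟨?_, ?_⟩, ?_, ?_⟩, ?_⟩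
    · intro i j hj hji hi
      dsimp only
      split_ifs
      · exact (hb _ (by omega)).1
      · have := hb (n - i + j - 1) (by omega)
        omega
    · intro i j hj hji hi
      obtain ⟨t, rfl⟩ := Nat.exists_eq_add_of_le hi
      have e1 : i + 1 + t - i = t + 1 := by omega
      have e2 : i + 1 + t - (i + 1) = t := by omega
      simp only [e1, e2]
      rcases (by omega : j = 1 ∨ 2 ≤ j) with rfl | hj
      · have h1 := hs t (by omega)
        have := hb (t + 1) (by omega)
        simp
        omega
      · rw [if_neg (by omega), if_neg (by omega), if_neg (by omega),
          show t + 1 + j - 1 = t + j by omega, show t + (j + 1) - 1 = t + j by omega]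
        have h2 := hs (t + j - 1) (by omega)
        rw [show t + j - 1 + 1 = t + j by omega] at h2
        omega
    · dsimp only
      split_ifs with h
      · subst h
        simp [hf.1]
      · have := hb (n - 1) (by omega)
        rw [show n - n + n - 1 = n - 1 by omega]
        omega
    · intro k hk hkn j hj0 hj hj1
      obtain ⟨m, hm⟩ : ∃ m, n - k = m + 1 := ⟨n - k - 1, by omega⟩
      rw [hm] at hj hj1 ⊢
      have hup : ∀ i, i ≤ m + 1 → j i + i ≤ n := by
        intro i hi
        induction i with
        | zero => omega
        | succ i ih =>
          have := ih (by omega)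
          have := hj i (by omega)
          omega
      have hlow : ∀ i, i ≤ m → 2 ≤ j i := by
        intro i hi
        induction hi using Nat.decreasingInduction with
        | self => have := hj m (by omega); omega
        | of_succ i hi ih => have := hj i (by omega); omega
      have hval : ∀ i x, 2 ≤ x → x + i ≤ n → n - (x + i) + x - 1 = n - i - 1 := by
        intro i x _ _
        omega
      have hu := hup (m + 1) le_rfl
      rw [Finset.sum_range_succ, Finset.sum_eq_zero, zero_add]
      · have hm2 := hlow m le_rfl
        dsimp only
        rw [if_neg (by omega), hval _ _ (hlow m le_rfl) (hup m (by omega))]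
        split_ifs with h1
        · rw [h1]
          have h2 := hs (n - m - 2) (by omega)
          rw [show n - m - 2 + 1 = n - m - 1 by omega] at h2
          rw [show n - (1 + m) = n - m - 1 by omega, show n - (1 + (m + 1)) = n - m - 2 by omega]
          omega
        · rw [hval m _ (by omega) (by omega), hval (m + 1) _ (by omega) (by omega)]
          have := hb (n - (m + 1) - 1) (by omega)
          omega
      · intro i hi
        rw [Finset.mem_range] at hi
        have h1 := hlow i (by omega)
        have h2 := hlow (i + 1) (by omega)
        have h3 := hup i (by omega)
        have h4 := hup (i + 1) (by omega)
        dsimp only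
        rw [if_neg (by omega), if_neg (by omega), hval _ _ h1 h3, hval _ _ h2 (by omega), sub_self]
    · intro i j
      unfold ofPath
      dsimp only
      split_ifs <;> first
        | rfl
        | omega
        | rw [show n - i + j - 1 = n - i + 1 by omega]

/-- For every `n ≥ 1` and every positive integer `l`, the `(n,2)` left Gog and left
GOGAm trapezoids with bottom entry `X 1 1 = l` are equienumerated. -/
theorem left_trapezoids_width2_refined_equienumerated (n l : ℕ) (hn : 1 ≤ n)
    (hl : 1 ≤ l) :
    Set.ncard { X | X ∈ LeftGogTrapSet n 2 ∧ X 1 1 = l } =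
    Set.ncard { X | X ∈ LeftGOGAmTrapSet n 2 ∧ X 1 1 = l } := by
  rw [ncard_eq_sum_pathsTo gogPred (fun t p q h => (mem_gogPred.1 h).2.2.2.1) n l hn _
      (mem_leftGog_iff n hn),
    ncard_eq_sum_pathsTo gogamPred (fun t p q h => (mem_gogamPred.1 h).2.2.2.1) n l hn _
      (mem_leftGOGAm_iff n hn), sum_card_gog_eq n l hn]
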